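/- arXiv:1507.02389 — 2 statements merged into one kernel-verified Lean document; each statement's English description precedes it below -/
import Mathlib

section
/- Let d ≥ 1 and suppose W : ℝ^d → ℝ can be written as W = W_c + W_l, where W_c is C² with Hess(W_c) ≥ ρ I_d (ρ > 0) and W_l is l-Lipschitz with respect to the Euclidean distance. Let a_d = E[|Z|] for Z standard Gaussian in ℝ^d (so a₁ = √(2/π)). Then for every σ > 0, W can be written as W = U_c + U_b, where U_c is C² with Hess(U_c) ≥ (ρ − l a₁/σ) I_d and |U_b| ≤ l σ a_d everywhere. -/
open MeasureTheory Real

/-- The standard Gaussian measure `N(0, I_d)` on `ℝ^d`. -/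
noncomputable def stdGauss (d : ℕ) : Measure (EuclideanSpace ℝ (Fin d)) :=
  volume.withDensity fun z =>
    ENNReal.ofReal ((2 * π) ^ (-(d : ℝ) / 2) * Real.exp (-‖z‖ ^ 2 / 2))

/-- `a_d = E[|Z|]` for `Z` a standard Gaussian vector in `ℝ^d`. -/
noncomputable def gaussNormMean (d : ℕ) : ℝ := ∫ z, ‖z‖ ∂(stdGauss d)

/-- `Hess U ≥ α I_d` for a function `U : ℝ^d → ℝ`. -/
def HessGE {d : ℕ} (U : EuclideanSpace ℝ (Fin d) → ℝ) (α : ℝ) : Prop :=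
  ∀ x v : EuclideanSpace ℝ (Fin d), α * ‖v‖ ^ 2 ≤ fderiv ℝ (fderiv ℝ U) x v v


lemma dens_integrable (d : ℕ) : Integrable (fun z : EuclideanSpace ℝ (Fin d) =>
    (2 * π) ^ (-(d : ℝ) / 2) * Real.exp (-‖z‖ ^ 2 / 2)) := by
  apply Integrable.const_mul
  have h := GaussianFourier.integral_rexp_neg_mul_sq_norm
    (V := EuclideanSpace ℝ (Fin d)) (b := 1 / 2) (by norm_num)
  have h2 : Integrable (fun z : EuclideanSpace ℝ (Fin d) => Real.exp (-(1 / 2) * ‖z‖ ^ 2)) := by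
    by_contra hc
    rw [integral_undef hc] at h
    have : 0 < (π / (1 / 2)) ^ (Module.finrank ℝ (EuclideanSpace ℝ (Fin d)) / 2 : ℝ) := by
      positivity
    linarith
  refine h2.congr (Filter.Eventually.of_forall fun z => ?_)
  simp only
  congr 1
  ring

lemma integral_stdGauss {d : ℕ} {F : Type*} [NormedAddCommGroup F] [NormedSpace ℝ F]
    (g : EuclideanSpace ℝ (Fin d) → F) :
    ∫ z, g z ∂(stdGauss d) =
      ∫ z, ((2 * π) ^ (-(d : ℝ) / 2) * Real.exp (-‖z‖ ^ 2 / 2)) • g z := by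
  rw [stdGauss, integral_withDensity_eq_integral_toReal_smul (by fun_prop) (by simp)]
  refine integral_congr_ae (Filter.Eventually.of_forall fun z => ?_)
  simp only
  rw [ENNReal.toReal_ofReal (by positivity)]

lemma stdGauss_eq (d : ℕ) :
    stdGauss d = ProbabilityTheory.stdGaussian (EuclideanSpace ℝ (Fin d)) := by
  have : IsFiniteMeasure (stdGauss d) :=
    isFiniteMeasure_withDensity_ofReal (dens_integrable d).hasFiniteIntegral
  apply Measure.ext_of_charFun
  ext t
  rw [ProbabilityTheory.charFun_stdGaussian, charFun_apply, integral_stdGauss]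
  have h := GaussianFourier.integral_cexp_neg_mul_sq_norm_add
    (V := EuclideanSpace ℝ (Fin d)) (b := 1 / 2) (by norm_num) Complex.I t
  have h3 : ∀ z : EuclideanSpace ℝ (Fin d),
      ((2 * π) ^ (-(d : ℝ) / 2) * Real.exp (-‖z‖ ^ 2 / 2)) •
        Complex.exp ((inner ℝ z t : ℝ) * Complex.I) =
      (((2 * π) ^ (-(d : ℝ) / 2) : ℝ) : ℂ) *
        Complex.exp (-(1 / 2) * ‖z‖ ^ 2 + Complex.I * (inner ℝ t z : ℝ)) := by
    intro z
    rw [Complex.exp_add, Complex.real_smul, Complex.ofReal_mul, Complex.ofReal_exp,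
      real_inner_comm t z, mul_assoc, mul_comm Complex.I]
    congr 3
    push_cast
    ring
  simp_rw [h3]
  rw [integral_const_mul, h, ← mul_assoc]
  have h4 : (((2 * π) ^ (-(d : ℝ) / 2) : ℝ) : ℂ) *
      (π / (1 / 2)) ^ (Module.finrank ℝ (EuclideanSpace ℝ (Fin d)) / 2 : ℂ) = 1 := by
    have : ((π : ℂ) / (1 / 2)) = ((2 * π : ℝ) : ℂ) := by push_cast; ring
    rw [this, finrank_euclideanSpace_fin]
    have h5 : ((d : ℂ) / 2) = (((d : ℝ) / 2 : ℝ) : ℂ) := by push_cast; ring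
    rw [h5, ← Complex.ofReal_cpow (by positivity), ← Complex.ofReal_mul,
      ← Real.rpow_add (by positivity)]
    rw [show -(d : ℝ) / 2 + d / 2 = 0 by ring]
    simp
  rw [h4, one_mul, Complex.I_sq]
  congr 1
  ring

instance stdGauss_isGaussian (d : ℕ) : ProbabilityTheory.IsGaussian (stdGauss d) := by
  rw [stdGauss_eq]; infer_instance

lemma integral_abs_inner (d : ℕ) (v : EuclideanSpace ℝ (Fin d)) :
    ∫ z, |inner ℝ v z| ∂(stdGauss d) =
      ‖v‖ * ∫ t, |t| ∂(ProbabilityTheory.gaussianReal 0 1) := by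
  have h := ProbabilityTheory.IsGaussian.map_eq_gaussianReal (μ := stdGauss d) (innerSL ℝ v)
  have h1 : ∫ z, |inner ℝ v z| ∂(stdGauss d) =
      ∫ t, |t| ∂((stdGauss d).map (innerSL ℝ v)) := by
    rw [integral_map (by fun_prop) (by fun_prop)]
    rfl
  have h2 : ProbabilityTheory.gaussianReal 0 (‖v‖ ^ 2).toNNReal =
      (ProbabilityTheory.gaussianReal 0 1).map (fun x => ‖v‖ * x) := by
    rw [ProbabilityTheory.gaussianReal_map_const_mul]
    congr 1
    · simp
    · ext; simp
  rw [h1, h, stdGauss_eq, ProbabilityTheory.integral_strongDual_stdGaussian,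
    ProbabilityTheory.variance_dual_stdGaussian, innerSL_apply_norm, h2,
    integral_map (by fun_prop) (by fun_prop), ← integral_const_mul]
  simp [abs_mul]

lemma gaussNormMean_one : gaussNormMean 1 = ∫ t, |t| ∂(ProbabilityTheory.gaussianReal 0 1) := by
  have h := integral_abs_inner 1 (EuclideanSpace.single 0 1)
  rw [gaussNormMean]
  simp only [PiLp.norm_single, norm_one, one_mul] at h
  rw [← h]
  refine integral_congr_ae (Filter.Eventually.of_forall fun z => ?_)
  simp [EuclideanSpace.norm_eq, EuclideanSpace.inner_single_left, Real.sqrt_sq_eq_abs]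

lemma integral_abs_inner' (d : ℕ) (v : EuclideanSpace ℝ (Fin d)) :
    ∫ z, |inner ℝ v z| ∂(stdGauss d) = ‖v‖ * gaussNormMean 1 := by
  rw [integral_abs_inner, gaussNormMean_one]

lemma integrable_exp_norm (d : ℕ) (K : ℝ) :
    Integrable (fun y : EuclideanSpace ℝ (Fin d) => Real.exp (K * ‖y‖)) (stdGauss d) := by
  obtain ⟨C, hC, hi⟩ := ProbabilityTheory.IsGaussian.exists_integrable_exp_sq (stdGauss d)
  refine (hi.const_mul (Real.exp (K ^ 2 / (4 * C)))).mono' (by fun_prop)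
    (Filter.Eventually.of_forall fun y => ?_)
  rw [Real.norm_eq_abs, abs_of_pos (Real.exp_pos _), ← Real.exp_add]
  apply Real.exp_le_exp.2
  have : K ^ 2 / (4 * C) + C * ‖y‖ ^ 2 - K * ‖y‖ = C * (‖y‖ - K / (2 * C)) ^ 2 := by
    field_simp
    ring
  nlinarith [mul_nonneg hC.le (sq_nonneg (‖y‖ - K / (2 * C)))]

lemma integrable_of_growth {d : ℕ} {F : Type*} [NormedAddCommGroup F]
    {f : EuclideanSpace ℝ (Fin d) → F} (hf : Continuous f) {C K : ℝ}
    (hb : ∀ y, ‖f y‖ ≤ C * Real.exp (K * ‖y‖)) : Integrable f (stdGauss d) :=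
  ((integrable_exp_norm d K).const_mul C).mono' hf.aestronglyMeasurable
    (Filter.Eventually.of_forall hb)

/-- Laplace-type transform. -/
noncomputable def lapT {d : ℕ} {F : Type*} [NormedAddCommGroup F] [NormedSpace ℝ F]
    (f : EuclideanSpace ℝ (Fin d) → F) (x : EuclideanSpace ℝ (Fin d)) : F :=
  ∫ y, Real.exp (inner ℝ x y) • f y ∂(stdGauss d)

/-- Derivative symbol. -/
noncomputable def lapD {d : ℕ} {F : Type*} [NormedAddCommGroup F] [NormedSpace ℝ F]
    (f : EuclideanSpace ℝ (Fin d) → F) (y : EuclideanSpace ℝ (Fin d)) :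
    EuclideanSpace ℝ (Fin d) →L[ℝ] F :=
  (innerSL ℝ y).smulRight (f y)

lemma growth_exp {d : ℕ} {F : Type*} [NormedAddCommGroup F] [NormedSpace ℝ F]
    {f : EuclideanSpace ℝ (Fin d) → F} {C K R : ℝ}
    (hb : ∀ y, ‖f y‖ ≤ C * Real.exp (K * ‖y‖)) (x : EuclideanSpace ℝ (Fin d)) (hx : ‖x‖ ≤ R)
    (y : EuclideanSpace ℝ (Fin d)) :
    ‖Real.exp (inner ℝ x y) • f y‖ ≤ C * Real.exp ((R + K) * ‖y‖) := by
  rw [norm_smul, Real.norm_eq_abs, abs_of_pos (Real.exp_pos _)]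
  have h1 : Real.exp (inner ℝ x y) ≤ Real.exp (R * ‖y‖) :=
    Real.exp_le_exp.2 ((real_inner_le_norm x y).trans (by gcongr))
  calc _ ≤ Real.exp (R * ‖y‖) * (C * Real.exp (K * ‖y‖)) :=
        mul_le_mul h1 (hb y) (norm_nonneg _) (Real.exp_pos _).le
    _ = _ := by rw [add_mul, Real.exp_add]; ring

lemma lapD_growth {d : ℕ} {F : Type*} [NormedAddCommGroup F] [NormedSpace ℝ F]
    {f : EuclideanSpace ℝ (Fin d) → F} {C K : ℝ}
    (hb : ∀ y, ‖f y‖ ≤ C * Real.exp (K * ‖y‖)) (y : EuclideanSpace ℝ (Fin d)) :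
    ‖lapD f y‖ ≤ C * Real.exp ((1 + K) * ‖y‖) := by
  rw [lapD, ContinuousLinearMap.norm_smulRight_apply, innerSL_apply_norm]
  have h1 : ‖y‖ ≤ Real.exp (1 * ‖y‖) := by
    have := Real.add_one_le_exp ‖y‖
    rw [one_mul]; linarith
  calc _ ≤ Real.exp (1 * ‖y‖) * (C * Real.exp (K * ‖y‖)) :=
        mul_le_mul h1 (hb y) (norm_nonneg _) (Real.exp_pos _).le
    _ = _ := by rw [add_mul, Real.exp_add]; ring

lemma lapD_continuous {d : ℕ} {F : Type*} [NormedAddCommGroup F] [NormedSpace ℝ F]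
    {f : EuclideanSpace ℝ (Fin d) → F} (hf : Continuous f) : Continuous (lapD f) := by
  unfold lapD
  fun_prop

lemma lapT_hasFDerivAt {d : ℕ} {F : Type*} [NormedAddCommGroup F] [NormedSpace ℝ F]
    {f : EuclideanSpace ℝ (Fin d) → F} (hf : Continuous f) {C K : ℝ}
    (hb : ∀ y, ‖f y‖ ≤ C * Real.exp (K * ‖y‖)) (x : EuclideanSpace ℝ (Fin d)) :
    HasFDerivAt (lapT f) (lapT (lapD f) x) x := by
  unfold lapT
  have hD := lapD_continuous hf
  refine hasFDerivAt_integral_of_dominated_of_fderiv_le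
    (F := fun x y => Real.exp (inner ℝ x y) • f y)
    (F' := fun x y => Real.exp (inner ℝ x y) • lapD f y)
    (bound := fun y => C * Real.exp (((‖x‖ + 1) + (1 + K)) * ‖y‖))
    (Metric.ball_mem_nhds x one_pos) ?_ ?_ ?_ ?_ ?_ ?_
  · exact Filter.Eventually.of_forall fun z => Continuous.aestronglyMeasurable (by fun_prop)
  · exact integrable_of_growth (by fun_prop) (growth_exp hb x le_rfl)
  · exact Continuous.aestronglyMeasurable (by fun_prop)
  · refine Filter.Eventually.of_forall fun y z hz => ?_
    refine growth_exp (lapD_growth hb) z ?_ y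
    have := norm_sub_norm_le z x
    rw [mem_ball_iff_norm] at hz
    linarith
  · exact (integrable_exp_norm d _).const_mul C
  · refine Filter.Eventually.of_forall fun y z _ => ?_
    have h1 : HasFDerivAt (fun z : EuclideanSpace ℝ (Fin d) => inner ℝ z y) (innerSL ℝ y) z := by
      have := (innerSL ℝ y).hasFDerivAt (x := z)
      refine this.congr_of_eventuallyEq (Filter.Eventually.of_forall fun w => ?_)
      simp [real_inner_comm]
    have h2 := h1.exp.smul_const (f y)
    convert h2 using 1
    ext v
    simp [lapD, smul_smul]

lemma lapT_contDiff {d : ℕ} (n : ℕ) : ∀ {F : Type} [NormedAddCommGroup F] [NormedSpace ℝ F]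
    {f : EuclideanSpace ℝ (Fin d) → F} (_ : Continuous f) {C K : ℝ}
    (_ : ∀ y, ‖f y‖ ≤ C * Real.exp (K * ‖y‖)), ContDiff ℝ n (lapT f) := by
  induction n with
  | zero =>
    intro F _ _ f hf C K hb
    exact contDiff_zero.2
      (continuous_iff_continuousAt.2 fun x => (lapT_hasFDerivAt hf hb x).continuousAt)
  | succ n ih =>
    intro F _ _ f hf C K hb
    push_cast
    rw [contDiff_succ_iff_fderiv]
    refine ⟨fun x => (lapT_hasFDerivAt hf hb x).differentiableAt, by simp, ?_⟩
    rw [show fderiv ℝ (lapT f) = lapT (lapD f) from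
      funext fun x => (lapT_hasFDerivAt hf hb x).fderiv]
    exact ih (lapD_continuous hf) (lapD_growth hb)

lemma tilt {d : ℕ} (g : EuclideanSpace ℝ (Fin d) → ℝ) (x : EuclideanSpace ℝ (Fin d)) :
    ∫ z, g (x + z) ∂(stdGauss d) = Real.exp (-‖x‖ ^ 2 / 2) * lapT g x := by
  rw [lapT, integral_stdGauss, integral_stdGauss, ← integral_const_mul]
  symm
  rw [← integral_add_left_eq_self _ x]
  refine integral_congr_ae (Filter.Eventually.of_forall fun z => ?_)
  simp only [smul_eq_mul]
  have : Real.exp (-‖z‖ ^ 2 / 2) =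
      Real.exp (-‖x‖ ^ 2 / 2) * Real.exp (-‖x + z‖ ^ 2 / 2) * Real.exp (inner ℝ x (x + z)) := by
    rw [← Real.exp_add, ← Real.exp_add, norm_add_sq_real, inner_add_right,
      real_inner_self_eq_norm_sq]
    congr 1
    ring
  rw [this]
  ring

/-- Gaussian smoothing. -/
noncomputable def gsm {d : ℕ} (f : EuclideanSpace ℝ (Fin d) → ℝ)
    (x : EuclideanSpace ℝ (Fin d)) : ℝ :=
  ∫ z, f (x + z) ∂(stdGauss d)

lemma lip_growth {d : ℕ} {f : EuclideanSpace ℝ (Fin d) → ℝ} {L : NNReal}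
    (hf : LipschitzWith L f) (x : EuclideanSpace ℝ (Fin d)) (y : EuclideanSpace ℝ (Fin d)) :
    ‖f (x + y)‖ ≤ (‖f x‖ + L) * Real.exp (1 * ‖y‖) := by
  have h := hf.dist_le_mul (x + y) x
  rw [dist_eq_norm, dist_eq_norm, add_sub_cancel_left] at h
  have h1 := norm_sub_norm_le (f (x + y)) (f x)
  have h2 := Real.add_one_le_exp ‖y‖
  have h3 := norm_nonneg y
  have h4 := norm_nonneg (f x)
  have h5 : (0 : ℝ) ≤ L := L.2
  rw [one_mul]
  nlinarith

lemma gsm_eq {d : ℕ} (f : EuclideanSpace ℝ (Fin d) → ℝ) :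
    gsm f = fun x => Real.exp (-‖x‖ ^ 2 / 2) * lapT f x :=
  funext fun x => tilt f x

lemma gsm_contDiff {d : ℕ} {f : EuclideanSpace ℝ (Fin d) → ℝ} {L : NNReal}
    (hf : LipschitzWith L f) : ContDiff ℝ 2 (gsm f) := by
  rw [gsm_eq]
  have h := lapT_contDiff 2 hf.continuous (fun y => by simpa only [zero_add] using lip_growth hf 0 y)
  have h1 : ContDiff ℝ 2 (fun x : EuclideanSpace ℝ (Fin d) => ‖x‖ ^ 2) := contDiff_norm_sq ℝ
  exact (h1.neg.div_const 2).exp.mul h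

lemma gsm_fderiv {d : ℕ} {f : EuclideanSpace ℝ (Fin d) → ℝ} {L : NNReal}
    (hf : LipschitzWith L f) (x v : EuclideanSpace ℝ (Fin d)) :
    fderiv ℝ (gsm f) x v = ∫ z, f (x + z) * inner ℝ v z ∂(stdGauss d) := by
  have hb : ∀ y, ‖f y‖ ≤ (‖f 0‖ + L) * Real.exp (1 * ‖y‖) := fun y => by
    simpa only [zero_add] using lip_growth hf 0 y
  have hT := lapT_hasFDerivAt hf.continuous hb x
  have hN : HasFDerivAt (fun x : EuclideanSpace ℝ (Fin d) => -‖x‖ ^ 2 / 2)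
      (-(innerSL ℝ x)) x := by
    have h := ((hasStrictFDerivAt_norm_sq x).hasFDerivAt).const_mul (-1 / 2 : ℝ)
    have e : (-1 / 2 : ℝ) • (2 : ℕ) • innerSL ℝ x = -(innerSL ℝ x) := by
      ext y
      simp
      try ring
    have e' : (fun y : EuclideanSpace ℝ (Fin d) => -1 / 2 * ‖y‖ ^ 2) =
        fun y => -‖y‖ ^ 2 / 2 := by
      ext y
      ring
    exact e' ▸ e ▸ h
  have hG : HasFDerivAt (fun x => Real.exp (-‖x‖ ^ 2 / 2) * lapT f x) _ x := hN.exp.mul hT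
  rw [gsm_eq, hG.fderiv]
  have hfc := hf.continuous
  have hDc := lapD_continuous hfc
  have i1 : Integrable (fun y => Real.exp (inner ℝ x y) • lapD f y) (stdGauss d) :=
    integrable_of_growth (by fun_prop) (growth_exp (lapD_growth hb) x le_rfl)
  have i0 : Integrable (fun y => Real.exp (inner ℝ x y) • f y) (stdGauss d) :=
    integrable_of_growth (by fun_prop) (growth_exp hb x le_rfl)
  have e1 : lapT (lapD f) x v =
      ∫ y, (Real.exp (inner ℝ x y) • lapD f y) v ∂(stdGauss d) := by
    rw [lapT, ContinuousLinearMap.integral_apply i1]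
  have e2 := tilt (fun y => f y * inner ℝ v (y - x)) x
  simp only [add_sub_cancel_left] at e2
  rw [e2]
  have e3 : lapT (fun y => f y * inner ℝ v (y - x)) x =
      lapT (lapD f) x v - inner ℝ x v * lapT f x := by
    rw [e1, lapT, lapT, ← integral_const_mul, ← integral_sub (i1.apply_continuousLinearMap v)
      (i0.const_mul _)]
    refine integral_congr_ae (Filter.Eventually.of_forall fun y => ?_)
    simp only [lapD, inner_sub_right, smul_eq_mul, ContinuousLinearMap.smul_apply,
      ContinuousLinearMap.smulRight_apply, innerSL_apply_apply, real_inner_comm v]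
    ring
  rw [e3]
  simp
  ring

lemma gsm_fderiv_lip {d : ℕ} {f : EuclideanSpace ℝ (Fin d) → ℝ} {L : NNReal}
    (hf : LipschitzWith L f) (x y : EuclideanSpace ℝ (Fin d)) :
    ‖fderiv ℝ (gsm f) x - fderiv ℝ (gsm f) y‖ ≤ L * gaussNormMean 1 * ‖x - y‖ := by
  have ha : 0 ≤ gaussNormMean 1 := integral_nonneg fun z => norm_nonneg z
  have hfc := hf.continuous
  refine ContinuousLinearMap.opNorm_le_bound _ (by positivity) fun v => ?_
  have hi : ∀ x, Integrable (fun z => f (x + z) * inner ℝ v z) (stdGauss d) := by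
    intro x
    refine integrable_of_growth (C := (‖f x‖ + L) * ‖v‖) (K := 1 + 1) (by fun_prop) fun z => ?_
    have h1 := lip_growth hf x z
    have h2 : ‖inner ℝ v z‖ ≤ ‖v‖ * Real.exp (1 * ‖z‖) := by
      refine (norm_inner_le_norm v z).trans ?_
      have := Real.add_one_le_exp ‖z‖
      rw [one_mul]
      gcongr
      linarith
    rw [norm_mul]
    calc _ ≤ ((‖f x‖ + L) * Real.exp (1 * ‖z‖)) * (‖v‖ * Real.exp (1 * ‖z‖)) := by gcongr
      _ = _ := by rw [add_mul 1 1, Real.exp_add]; ring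
  rw [sub_apply, gsm_fderiv hf, gsm_fderiv hf, ← integral_sub (hi x) (hi y)]
  have hI : Integrable (fun z => |inner ℝ v z|) (stdGauss d) :=
    ((ProbabilityTheory.IsGaussian.integrable_dual (stdGauss d) (innerSL ℝ v))).abs
  calc _ ≤ ∫ z, (L * ‖x - y‖) * |inner ℝ v z| ∂(stdGauss d) := by
        refine norm_integral_le_of_norm_le (hI.const_mul _)
          (Filter.Eventually.of_forall fun z => ?_)
        rw [← sub_mul, norm_mul, Real.norm_eq_abs (inner ℝ v z)]
        have h := hf.dist_le_mul (x + z) (y + z)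
        rw [dist_eq_norm, dist_eq_norm, add_sub_add_right_eq_sub] at h
        gcongr
    _ = _ := by rw [integral_const_mul, integral_abs_inner']; ring

/-- Miclo's trick: if `W = W_c + W_l` with `Hess W_c ≥ ρ I_d` and `W_l`
`l`-Lipschitz, then for every `σ > 0` one can write `W = U_c + U_b` with
`Hess U_c ≥ (ρ - l a₁/σ) I_d` and `|U_b| ≤ l σ a_d`. -/
theorem miclo_trick (d : ℕ) (hd : 1 ≤ d) (W Wc Wl : EuclideanSpace ℝ (Fin d) → ℝ)
    (hW : W = Wc + Wl) (ρ : ℝ) (hρ : 0 < ρ) (hWc : ContDiff ℝ 2 Wc)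
    (hHess : HessGE Wc ρ) (l : ℝ) (hl : 0 ≤ l)
    (hWl : LipschitzWith (Real.toNNReal l) Wl) :
    ∀ σ : ℝ, 0 < σ →
      ∃ Uc Ub : EuclideanSpace ℝ (Fin d) → ℝ,
        W = Uc + Ub ∧ ContDiff ℝ 2 Uc ∧
        HessGE Uc (ρ - l * gaussNormMean 1 / σ) ∧
        ∀ x, |Ub x| ≤ l * σ * gaussNormMean d := by
  intro σ hσ
  have ha : 0 ≤ gaussNormMean 1 := integral_nonneg fun z => norm_nonneg z
  set f : EuclideanSpace ℝ (Fin d) → ℝ := fun z => Wl (σ • z) with hfdef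
  have hf : LipschitzWith (Real.toNNReal (l * σ)) f := by
    refine LipschitzWith.of_dist_le_mul fun a b => ?_
    have h := hWl.dist_le_mul (σ • a) (σ • b)
    rw [dist_smul₀, Real.norm_eq_abs, abs_of_pos hσ, Real.coe_toNNReal l hl] at h
    rw [Real.coe_toNNReal _ (by positivity)]
    linarith
  set G : EuclideanSpace ℝ (Fin d) → ℝ := fun x => gsm f (σ⁻¹ • x) with hGdef
  have hg2 := gsm_contDiff hf
  have hG2 : ContDiff ℝ 2 G := hg2.comp (contDiff_const_smul σ⁻¹)
  have hDG : fderiv ℝ G = fun x => σ⁻¹ • fderiv ℝ (gsm f) (σ⁻¹ • x) :=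
    funext fun x => fderiv_comp_smul σ⁻¹
  have hDlip : LipschitzWith (Real.toNNReal (l * gaussNormMean 1 / σ)) (fderiv ℝ G) := by
    refine LipschitzWith.of_dist_le_mul fun a b => ?_
    rw [Real.coe_toNNReal _ (by positivity), hDG, dist_eq_norm, dist_eq_norm]
    simp only
    rw [← smul_sub, norm_smul, Real.norm_eq_abs, abs_of_pos (by positivity)]
    have h := gsm_fderiv_lip hf (σ⁻¹ • a) (σ⁻¹ • b)
    rw [Real.coe_toNNReal _ (by positivity), ← smul_sub, norm_smul, Real.norm_eq_abs,
      abs_of_pos (by positivity)] at h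
    calc _ ≤ σ⁻¹ * (l * σ * gaussNormMean 1 * (σ⁻¹ * ‖a - b‖)) := by gcongr
      _ = _ := by field_simp
  refine ⟨Wc + G, Wl - G, ?_, hWc.add hG2, ?_, ?_⟩
  · rw [hW]; abel
  · intro x v
    have d1 : fderiv ℝ (Wc + G) = fderiv ℝ Wc + fderiv ℝ G := by
      ext1 y
      exact fderiv_add (hWc.differentiable (by norm_num) y) (hG2.differentiable (by norm_num) y)
    have c1 : Differentiable ℝ (fderiv ℝ Wc) :=
      (hWc.fderiv_right (m := 1) (by norm_num)).differentiable (by norm_num)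
    have c2 : Differentiable ℝ (fderiv ℝ G) :=
      (hG2.fderiv_right (m := 1) (by norm_num)).differentiable (by norm_num)
    rw [d1, fderiv_add (c1 x) (c2 x)]
    have h1 := hHess x v
    have h2 : ‖fderiv ℝ (fderiv ℝ G) x‖ ≤ l * gaussNormMean 1 / σ := by
      have := norm_fderiv_le_of_lipschitz ℝ hDlip (x₀ := x)
      rwa [Real.coe_toNNReal _ (by positivity)] at this
    have h3 : |fderiv ℝ (fderiv ℝ G) x v v| ≤ l * gaussNormMean 1 / σ * ‖v‖ * ‖v‖ := by
      refine (ContinuousLinearMap.le_opNorm₂ (fderiv ℝ (fderiv ℝ G) x) v v).trans ?_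
      gcongr
    have h4 := (abs_le.1 h3).1
    simp only [add_apply]
    nlinarith
  · intro x
    have hn : Integrable (fun z : EuclideanSpace ℝ (Fin d) => ‖z‖) (stdGauss d) :=
      (ProbabilityTheory.IsGaussian.integrable_id (μ := stdGauss d)).norm
    have hfi : Integrable (fun z => f (σ⁻¹ • x + z)) (stdGauss d) :=
      integrable_of_growth (by have := hf.continuous; fun_prop) (lip_growth hf (σ⁻¹ • x))
    have e : (Wl - G) x = ∫ z, (Wl x - f (σ⁻¹ • x + z)) ∂(stdGauss d) := by
      rw [integral_sub (integrable_const _) hfi]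
      simp [hGdef, gsm]
    rw [e, gaussNormMean, ← integral_const_mul, ← Real.norm_eq_abs]
    refine norm_integral_le_of_norm_le (hn.const_mul _) (Filter.Eventually.of_forall fun z => ?_)
    have h := hf.dist_le_mul (σ⁻¹ • x) (σ⁻¹ • x + z)
    rw [dist_eq_norm, dist_self_add_right, Real.coe_toNNReal _ (by positivity)] at h
    have e2 : f (σ⁻¹ • x) = Wl x := by simp [hfdef, smul_smul, hσ.ne']
    rwa [e2] at h
end

section
/- Let d ≥ 1, R > 0, δ > 0, let μ be a probability measure on ℝ^d supported in the closed Euclidean ball B(0,R), and let X ~ μ and Z ~ N(0, I_d) be independent. Then for every 1-Lipschitz function f : ℝ^d → ℝ (with respect to the Euclidean distance), setting m = E[f(X + δZ)], one has for all t ≥ 0: P(f(X + δZ) ≥ m + t) ≤ exp(−(1/(2δ²)) · (max(t − 2R, 0))²). -/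
open MeasureTheory Metric Real ProbabilityTheory

lemma bm_compact (K L S : Set ℝ) (hK : IsCompact K) (hL : IsCompact L) (hKn : K.Nonempty)
    (hLn : L.Nonempty) (hS : ∀ x ∈ K, ∀ y ∈ L, x + y ∈ S) :
    volume K + volume L ≤ volume S := by
  obtain ⟨k, hk, hkm⟩ := hK.exists_isGreatest hKn
  obtain ⟨l, hl, hlm⟩ := hL.exists_isLeast hLn
  have h1 : volume ((fun x => x + l) '' K) = volume K := by
    rw [Set.image_add_right]; exact measure_preimage_add_right _ _ _
  have h2 : volume ((fun x => k + x) '' L) = volume L := by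
    rw [Set.image_add_left]; exact measure_preimage_add _ _ _
  have hm : MeasurableSet ((fun x => k + x) '' L) :=
    (hL.image (by fun_prop)).measurableSet
  have hd : AEDisjoint volume ((fun x => x + l) '' K) ((fun x => k + x) '' L) := by
    refine measure_mono_null (t := {k + l}) ?_ (by simp)
    rintro z ⟨⟨x, hx, rfl⟩, ⟨y, hy, hxy⟩⟩
    have a := hkm hx
    have b := hlm hy
    simp only at hxy ⊢
    simp only [Set.mem_singleton_iff]
    linarith
  rw [← h1, ← h2, ← measure_union₀ hm.nullMeasurableSet hd]
  apply measure_mono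
  rintro z (⟨x, hx, rfl⟩ | ⟨x, hx, rfl⟩)
  · exact hS _ hx _ hl
  · exact hS _ hk _ hx

lemma bm_meas (p q : ℝ) (hp : 0 < p) (hq : 0 < q) (A B S : Set ℝ) (hA : MeasurableSet A)
    (hB : MeasurableSet B) (hAn : A.Nonempty) (hBn : B.Nonempty)
    (hS : ∀ x ∈ A, ∀ y ∈ B, p * x + q * y ∈ S) :
    ENNReal.ofReal p * volume A + ENNReal.ofReal q * volume B ≤ volume S := by
  obtain ⟨a, ha⟩ := hAn
  obtain ⟨b, hb⟩ := hBn
  have key : ∀ K ⊆ A, IsCompact K → ∀ L ⊆ B, IsCompact L →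
      ENNReal.ofReal p * volume K + ENNReal.ofReal q * volume L ≤ volume S := by
    intro K hKA hK L hLB hL
    have := bm_compact ((fun x => p * x) '' (insert a K)) ((fun x => q * x) '' (insert b L)) S
      ((hK.insert a).image (by fun_prop)) ((hL.insert b).image (by fun_prop))
      ((Set.insert_nonempty _ _).image _) ((Set.insert_nonempty _ _).image _) ?_
    · refine le_trans ?_ this
      have e : ∀ (c : ℝ), 0 < c → ∀ T : Set ℝ,
          volume ((fun x => c * x) '' T) = ENNReal.ofReal c * volume T := by
        intro c hc T
        have := Measure.addHaar_smul (volume : Measure ℝ) c T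
        simp only [Module.finrank_self, pow_one, abs_of_pos hc] at this
        rw [← this]; rfl
      rw [e p hp, e q hq]
      gcongr <;> exact Set.subset_insert _ _
    · rintro _ ⟨x, hx, rfl⟩ _ ⟨y, hy, rfl⟩
      refine hS x ?_ y ?_
      · rcases hx with rfl | hx
        · exact ha
        · exact hKA hx
      · rcases hy with rfl | hy
        · exact hb
        · exact hLB hy
  rw [hA.measure_eq_iSup_isCompact, hB.measure_eq_iSup_isCompact]
  simp only [ENNReal.mul_iSup, iSup_and']
  refine ENNReal.biSup_add_biSup_le' ⟨∅, Set.empty_subset _, isCompact_empty⟩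
    ⟨∅, Set.empty_subset _, isCompact_empty⟩ ?_
  exact fun K hK L hL => key K hK.1 hK.2 L hL.1 hL.2

lemma amgm (p q : ℝ) (hp : 0 < p) (hq : 0 < q) (hpq : p + q = 1) (a b : ENNReal) :
    a ^ p * b ^ q ≤ ENNReal.ofReal p * a + ENNReal.ofReal q * b := by
  by_cases ha : a = ⊤
  · simp [ha, ENNReal.mul_top, hp]
  by_cases hb : b = ⊤
  · simp [hb, ENNReal.mul_top, hq]
  lift a to NNReal using ha
  lift b to NNReal using hb
  have := NNReal.geom_mean_le_arith_mean2_weighted p.toNNReal q.toNNReal a b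
    (by rw [← Real.toNNReal_add hp.le hq.le, hpq]; simp)
  rw [Real.coe_toNNReal _ hp.le, Real.coe_toNNReal _ hq.le] at this
  rw [← ENNReal.coe_rpow_of_nonneg _ hp.le, ← ENNReal.coe_rpow_of_nonneg _ hq.le, ENNReal.ofReal,
    ENNReal.ofReal]
  exact_mod_cast this

lemma layer (F : ℝ → ENNReal) (hF : Measurable F) (h : ∀ x, F x ≤ 1) :
    ∫⁻ x, F x = ∫⁻ t in Set.Ioi (0:ℝ), volume {x | ENNReal.ofReal t < F x} := by
  have hfin : ∀ x, F x ≠ ⊤ := fun x => ((h x).trans_lt ENNReal.one_lt_top).ne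
  have := lintegral_eq_lintegral_meas_lt (volume : Measure ℝ) (f := fun x => (F x).toReal)
    (Filter.Eventually.of_forall fun x => ENNReal.toReal_nonneg) hF.ennreal_toReal.aemeasurable
  simp only [ENNReal.ofReal_toReal (hfin _)] at this
  rw [this]
  refine setLIntegral_congr_fun measurableSet_Ioi fun t ht => ?_
  simp only [ENNReal.ofReal_lt_iff_lt_toReal (le_of_lt ht) (hfin _)]

/-- normalised one-dimensional Prekopa-Leindler -/
lemma pl_one_norm (p q : ℝ) (hp : 0 < p) (hq : 0 < q) (hpq : p + q = 1)
    (F G H : ℝ → ENNReal) (hF : Measurable F) (hG : Measurable G) (hH : Measurable H)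
    (hF1 : ⨆ x, F x = 1) (hG1 : ⨆ x, G x = 1)
    (h : ∀ x y, F x ^ p * G y ^ q ≤ H (p * x + q * y)) :
    (∫⁻ x, F x) ^ p * (∫⁻ x, G x) ^ q ≤ ∫⁻ x, H x := by
  have hF' : ∀ x, F x ≤ 1 := fun x => hF1 ▸ le_iSup F x
  have hG' : ∀ x, G x ≤ 1 := fun x => hG1 ▸ le_iSup G x
  refine (amgm p q hp hq hpq _ _).trans ?_
  refine le_trans ?_ (lintegral_mono (f := fun x => min (H x) 1) fun x => min_le_left _ _)
  rw [layer F hF hF', layer G hG hG', layer _ (hH.min measurable_const) fun x => min_le_right _ _]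
  have mF : ∀ K : ℝ → ENNReal, Measurable fun t : ℝ => volume {x | ENNReal.ofReal t < K x} := by
    intro K
    refine Antitone.measurable fun s t hst => measure_mono fun x hx => ?_
    exact lt_of_le_of_lt (ENNReal.ofReal_le_ofReal hst) hx
  rw [← lintegral_const_mul _ (mF F), ← lintegral_const_mul _ (mF G),
    ← lintegral_add_left ((mF F).const_mul _)]
  refine lintegral_mono fun t => ?_
  by_cases ht : ENNReal.ofReal t < 1
  · refine bm_meas p q hp hq _ _ _ (measurableSet_lt measurable_const hF)
      (measurableSet_lt measurable_const hG) ?_ ?_ ?_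
    · rw [← hF1] at ht; exact lt_iSup_iff.1 ht
    · rw [← hG1] at ht; exact lt_iSup_iff.1 ht
    · intro x hx y hy
      refine lt_min (lt_of_lt_of_le ?_ (h x y)) ht
      have : ENNReal.ofReal t = ENNReal.ofReal t ^ p * ENNReal.ofReal t ^ q := by
        rw [← ENNReal.rpow_add_of_nonneg _ _ hp.le hq.le, hpq, ENNReal.rpow_one]
      rw [this]
      exact ENNReal.mul_lt_mul (ENNReal.rpow_lt_rpow hx hp) (ENNReal.rpow_lt_rpow hy hq)
  · have e1 : {x | ENNReal.ofReal t < F x} = ∅ := by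
      ext x; simpa using (hF' x).trans (not_lt.1 ht)
    have e2 : {x | ENNReal.ofReal t < G x} = ∅ := by
      ext x; simpa using (hG' x).trans (not_lt.1 ht)
    simp [e1, e2]

lemma pl_one_bdd (p q : ℝ) (hp : 0 < p) (hq : 0 < q) (hpq : p + q = 1)
    (F G H : ℝ → ENNReal) (hF : Measurable F) (hG : Measurable G) (hH : Measurable H)
    (hF1 : ⨆ x, F x ≠ ⊤) (hG1 : ⨆ x, G x ≠ ⊤)
    (h : ∀ x y, F x ^ p * G y ^ q ≤ H (p * x + q * y)) :
    (∫⁻ x, F x) ^ p * (∫⁻ x, G x) ^ q ≤ ∫⁻ x, H x := by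
  by_cases hF0 : ⨆ x, F x = 0
  · simp only [ENNReal.iSup_eq_zero] at hF0
    simp [hF0, hp]
  by_cases hG0 : ⨆ x, G x = 0
  · simp only [ENNReal.iSup_eq_zero] at hG0
    simp [hG0, hq]
  set a := ⨆ x, F x with ha
  set b := ⨆ x, G x with hb
  have key := pl_one_norm p q hp hq hpq (fun x => a⁻¹ * F x) (fun x => b⁻¹ * G x)
    (fun x => ((a⁻¹) ^ p * (b⁻¹) ^ q) * H x) (hF.const_mul _) (hG.const_mul _) (hH.const_mul _)
    (by rw [← ENNReal.mul_iSup, ← ha, ENNReal.inv_mul_cancel hF0 hF1])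
    (by rw [← ENNReal.mul_iSup, ← hb, ENNReal.inv_mul_cancel hG0 hG1])
    (fun x y => by
      rw [ENNReal.mul_rpow_of_nonneg _ _ hp.le, ENNReal.mul_rpow_of_nonneg _ _ hq.le,
        mul_mul_mul_comm]
      gcongr; exact h x y)
  rw [lintegral_const_mul _ hF, lintegral_const_mul _ hG, lintegral_const_mul _ hH,
    ENNReal.mul_rpow_of_nonneg _ _ hp.le, ENNReal.mul_rpow_of_nonneg _ _ hq.le,
        mul_mul_mul_comm] at key
  refine (ENNReal.mul_le_mul_iff_right ?_ ?_).1 key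
  · simp [hF0, hF1, hG0, hG1, ENNReal.rpow_eq_zero_iff]
  · refine ENNReal.mul_ne_top ?_ ?_
    · simp [hF0, hF1, ENNReal.rpow_eq_top_iff, hp.le]
    · simp [hG0, hG1, ENNReal.rpow_eq_top_iff, hq.le]

lemma trunc (F : ℝ → ENNReal) (hF : Measurable F) :
    ∫⁻ x, F x = ⨆ n : ℕ, ∫⁻ x, min (F x) n := by
  rw [← lintegral_iSup (fun n => hF.min measurable_const)]
  · congr 1; ext x
    rw [← inf_iSup_eq, ENNReal.iSup_natCast]; simp
  · intro i j hij x
    simp only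
    gcongr

lemma rpow_iSup (p : ℝ) (hp : 0 < p) (u : ℕ → ENNReal) : (⨆ n, u n) ^ p = ⨆ n, u n ^ p :=
  (ENNReal.orderIsoRpow p hp).map_iSup u

lemma pl_one (p q : ℝ) (hp : 0 < p) (hq : 0 < q) (hpq : p + q = 1)
    (F G H : ℝ → ENNReal) (hF : Measurable F) (hG : Measurable G) (hH : Measurable H)
    (h : ∀ x y, F x ^ p * G y ^ q ≤ H (p * x + q * y)) :
    (∫⁻ x, F x) ^ p * (∫⁻ x, G x) ^ q ≤ ∫⁻ x, H x := by
  rw [trunc F hF, trunc G hG, rpow_iSup p hp, rpow_iSup q hq, ENNReal.iSup_mul]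
  refine iSup_le fun n => ?_
  rw [ENNReal.mul_iSup]
  refine iSup_le fun m => ?_
  refine pl_one_bdd p q hp hq hpq _ _ _ (hF.min measurable_const) (hG.min measurable_const) hH
    ?_ ?_ ?_
  · exact ((iSup_le fun x => min_le_right _ _).trans_lt (ENNReal.natCast_lt_top n)).ne
  · exact ((iSup_le fun x => min_le_right _ _).trans_lt (ENNReal.natCast_lt_top m)).ne
  · intro x y
    refine le_trans ?_ (h x y)
    gcongr <;> exact min_le_left _ _

lemma pl_pi (p q : ℝ) (hp : 0 < p) (hq : 0 < q) (hpq : p + q = 1) (n : ℕ) :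
    ∀ (F G H : (Fin n → ℝ) → ENNReal), Measurable F → Measurable G → Measurable H →
    (∀ x y, F x ^ p * G y ^ q ≤ H (p • x + q • y)) →
    (∫⁻ x, F x) ^ p * (∫⁻ x, G x) ^ q ≤ ∫⁻ x, H x := by
  induction n with
  | zero =>
    intro F G H hF hG hH h
    have e : ∀ K : (Fin 0 → ℝ) → ENNReal, ∫⁻ x, K x = K default := by
      intro K
      rw [lintegral_unique]; simp [volume_pi]; exact congrArg K (Subsingleton.elim _ _)
    rw [e, e, e]
    convert h default default
  | succ n ih =>
    intro F G H hF hG hH h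
    have mp := (volume_preserving_piFinSuccAbove (fun _ : Fin (n + 1) => ℝ) 0).symm
    have e : ∀ K : (Fin (n+1) → ℝ) → ENNReal, Measurable K →
        ∫⁻ x, K x = ∫⁻ a : ℝ, ∫⁻ x : Fin n → ℝ, K (Fin.cons a x) := by
      intro K hK
      rw [← mp.lintegral_comp hK]
      rw [Measure.volume_eq_prod, lintegral_prod _ (by fun_prop)]
      simp [MeasurableEquiv.piFinSuccAbove, Fin.insertNthEquiv]
    have mc : Measurable fun z : ℝ × (Fin n → ℝ) => (Fin.cons z.1 z.2 : Fin (n+1) → ℝ) := by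
      refine measurable_pi_iff.2 fun i => ?_
      refine Fin.cases ?_ (fun j => ?_) i
      · simpa using measurable_fst
      · simp only [Fin.cons_succ]; fun_prop
    have mi : ∀ K : (Fin (n+1) → ℝ) → ENNReal, Measurable K →
        Measurable fun a : ℝ => ∫⁻ x : Fin n → ℝ, K (Fin.cons a x) := fun K hK =>
      (hK.comp mc).lintegral_prod_right'
    have mj : ∀ K : (Fin (n+1) → ℝ) → ENNReal, Measurable K → ∀ a : ℝ,
        Measurable fun x : Fin n → ℝ => K (Fin.cons a x) := fun K hK a =>
      (hK.comp mc).comp measurable_prodMk_left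
    rw [e F hF, e G hG, e H hH]
    refine pl_one p q hp hq hpq _ _ _ (mi F hF) (mi G hG) (mi H hH) fun a b => ?_
    refine ih _ _ _ (mj F hF a) (mj G hG b) (mj H hH _) fun x y => ?_
    convert h (Fin.cons a x) (Fin.cons b y) using 2
    ext i
    refine Fin.cases ?_ (fun j => ?_) i <;> simp

lemma pl_euc (p q : ℝ) (hp : 0 < p) (hq : 0 < q) (hpq : p + q = 1) (n : ℕ)
    (F G H : EuclideanSpace ℝ (Fin n) → ENNReal) (hF : Measurable F) (hG : Measurable G)
    (hH : Measurable H)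
    (h : ∀ x y, F x ^ p * G y ^ q ≤ H (p • x + q • y)) :
    (∫⁻ x, F x) ^ p * (∫⁻ x, G x) ^ q ≤ ∫⁻ x, H x := by
  have mp := PiLp.volume_preserving_toLp (Fin n)
  rw [← mp.lintegral_comp hF, ← mp.lintegral_comp hG, ← mp.lintegral_comp hH]
  refine pl_pi p q hp hq hpq n _ _ _ (hF.comp mp.measurable) (hG.comp mp.measurable)
    (hH.comp mp.measurable) fun x y => ?_
  exact h _ _

lemma ofReal_exp_rpow (u p : ℝ) :
    (ENNReal.ofReal (Real.exp u)) ^ p = ENNReal.ofReal (Real.exp (u * p)) := by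
  rw [ENNReal.ofReal_rpow_of_pos (Real.exp_pos _), Real.exp_mul]

lemma norm_conv_sq {d : ℕ} (p q : ℝ) (hpq : p + q = 1) (x y : EuclideanSpace ℝ (Fin d)) :
    ‖p • x + q • y‖ ^ 2 = p * ‖x‖ ^ 2 + q * ‖y‖ ^ 2 - p * q * ‖x - y‖ ^ 2 := by
  obtain rfl : p = 1 - q := by linarith
  rw [norm_add_sq_real, norm_sub_sq_real, norm_smul, norm_smul, inner_smul_left, inner_smul_right,
    mul_pow, mul_pow, Real.norm_eq_abs, Real.norm_eq_abs, sq_abs, sq_abs]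
  simp only [conj_trivial]
  ring

lemma lintegral_stdGauss (d : ℕ) : ∃ k : ℝ, ∀ u : EuclideanSpace ℝ (Fin d) → ℝ, Measurable u →
    ∫⁻ z, ENNReal.ofReal (Real.exp (u z)) ∂(stdGauss d) =
      ∫⁻ z, ENNReal.ofReal (Real.exp (k - ‖z‖ ^ 2 / 2 + u z)) := by
  have hC : (0:ℝ) < (2 * π) ^ (-(d : ℝ) / 2) := by positivity
  refine ⟨Real.log ((2 * π) ^ (-(d : ℝ) / 2)), fun u hu => ?_⟩
  rw [stdGauss, lintegral_withDensity_eq_lintegral_mul _ (by fun_prop) (by fun_prop)]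
  refine lintegral_congr fun z => ?_
  rw [Pi.mul_apply, ← ENNReal.ofReal_mul (by positivity), Real.exp_add, sub_eq_add_neg,
    Real.exp_add, Real.exp_log hC, neg_div (2 : ℝ) (‖z‖ ^ 2)]

lemma mgf_step (d : ℕ) [IsProbabilityMeasure (stdGauss d)] (g : EuclideanSpace ℝ (Fin d) → ℝ)
    (L : ℝ) (hgm : Measurable g) (hg : ∀ x y, g x - g y ≤ L * ‖x - y‖)
    (hint : Integrable g (stdGauss d)) (h0 : ∫ z, g z ∂(stdGauss d) = 0) (l : ℝ) (hl : 0 ≤ l)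
    (q : ℝ) (hq : 0 < q) (hq1 : q < 1) :
    ∫⁻ z, ENNReal.ofReal (Real.exp (l * g z)) ∂(stdGauss d) ≤
      ENNReal.ofReal (Real.exp (l ^ 2 * L ^ 2 / (2 * (1 - q)))) := by
  obtain ⟨k, hk⟩ := lintegral_stdGauss d
  set p := 1 - q with hpdef
  have hp : 0 < p := by linarith
  have hpq : p + q = 1 := by linarith
  have key := pl_euc p q hp hq hpq d
    (fun z => ENNReal.ofReal (Real.exp (k - ‖z‖ ^ 2 / 2 + -(q * l / p) * g z)))
    (fun z => ENNReal.ofReal (Real.exp (k - ‖z‖ ^ 2 / 2 + l * g z)))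
    (fun z => ENNReal.ofReal (Real.exp (k - ‖z‖ ^ 2 / 2 + q * (l ^ 2 * L ^ 2 / (2 * p)))))
    (by fun_prop) (by fun_prop) (by fun_prop) (fun x y => by
      rw [ofReal_exp_rpow, ofReal_exp_rpow, ← ENNReal.ofReal_mul (by positivity), ← Real.exp_add]
      refine ENNReal.ofReal_le_ofReal (Real.exp_le_exp.2 ?_)
      rw [norm_conv_sq p q hpq]
      have h1 : l * (g y - g x) ≤ l * (L * ‖x - y‖) := by
        rw [norm_sub_rev]; exact mul_le_mul_of_nonneg_left (hg y x) hl
      have h2 : l * (L * ‖x - y‖) ≤ p * ‖x - y‖ ^ 2 / 2 + l ^ 2 * L ^ 2 / (2 * p) := by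
        have : p * ‖x - y‖ ^ 2 / 2 + l ^ 2 * L ^ 2 / (2 * p) - l * (L * ‖x - y‖)
            = (p * ‖x - y‖ - l * L) ^ 2 / (2 * p) := by field_simp; ring
        have : 0 ≤ (p * ‖x - y‖ - l * L) ^ 2 / (2 * p) := by positivity
        linarith
      have h3 := mul_le_mul_of_nonneg_left (h1.trans h2) hq.le
      have h4 : -(q * l / p) * g x * p = - (q * l * g x) := by field_simp
      have h5 : k * p + k * q = k := by rw [← mul_add, hpq, mul_one]
      nlinarith)
  rw [← hk _ (by fun_prop), ← hk _ (by fun_prop), ← hk _ (by fun_prop)] at key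
  have j : 1 ≤ ∫⁻ z, ENNReal.ofReal (Real.exp (-(q * l / p) * g z)) ∂(stdGauss d) := by
    set a := -(q * l / p)
    by_cases hf : ∫⁻ z, ENNReal.ofReal (Real.exp (a * g z)) ∂(stdGauss d) = ⊤
    · rw [hf]; exact le_top
    have hi : Integrable (fun z => Real.exp (a * g z)) (stdGauss d) := by
      refine ⟨by fun_prop, ?_⟩
      rw [hasFiniteIntegral_iff_ofReal (Filter.Eventually.of_forall fun z => (Real.exp_pos _).le)]
      exact lt_top_iff_ne_top.2 hf
    rw [← ofReal_integral_eq_lintegral_ofReal hi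
      (Filter.Eventually.of_forall fun z => (Real.exp_pos _).le), ENNReal.one_le_ofReal]
    calc (1:ℝ) = ∫ z, (a * g z + 1) ∂(stdGauss d) := by
          rw [integral_add (hint.const_mul a) (integrable_const _), integral_const_mul, h0]; simp
      _ ≤ _ := integral_mono ((hint.const_mul a).add (integrable_const _)) hi
          fun z => Real.add_one_le_exp _
  have key2 : (∫⁻ z, ENNReal.ofReal (Real.exp (l * g z)) ∂(stdGauss d)) ^ q ≤
      (ENNReal.ofReal (Real.exp (l ^ 2 * L ^ 2 / (2 * p)))) ^ q := by
    rw [ofReal_exp_rpow, mul_comm _ q]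
    have : (1 : ENNReal) ≤ (∫⁻ z, ENNReal.ofReal (Real.exp (-(q * l / p) * g z)) ∂(stdGauss d)) ^ p :=
      ENNReal.one_le_rpow j hp
    simp only [lintegral_const, measure_univ, mul_one] at key
    refine le_trans ?_ key
    exact le_mul_of_one_le_left' this
  exact (ENNReal.rpow_le_rpow_iff hq).1 key2

lemma mgf_bound (d : ℕ) [IsProbabilityMeasure (stdGauss d)] (g : EuclideanSpace ℝ (Fin d) → ℝ)
    (L : ℝ) (hgm : Measurable g) (hg : ∀ x y, g x - g y ≤ L * ‖x - y‖)
    (hint : Integrable g (stdGauss d)) (h0 : ∫ z, g z ∂(stdGauss d) = 0) (l : ℝ) (hl : 0 ≤ l) :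
    ∫⁻ z, ENNReal.ofReal (Real.exp (l * g z)) ∂(stdGauss d) ≤
      ENNReal.ofReal (Real.exp (l ^ 2 * L ^ 2 / 2)) := by
  have ht : Filter.Tendsto (fun q : ℝ => ENNReal.ofReal (Real.exp (l ^ 2 * L ^ 2 / (2 * (1 - q)))))
      (nhdsWithin 0 (Set.Ioi 0)) (nhds (ENNReal.ofReal (Real.exp (l ^ 2 * L ^ 2 / 2)))) := by
    have : ContinuousAt
        (fun q : ℝ => ENNReal.ofReal (Real.exp (l ^ 2 * L ^ 2 / (2 * (1 - q))))) 0 := by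
      refine ENNReal.continuous_ofReal.continuousAt.comp
        (Real.continuous_exp.continuousAt.comp ?_)
      exact ContinuousAt.div (by fun_prop) (by fun_prop) (by norm_num)
    have h := this.tendsto
    simp only [sub_zero, mul_one] at h
    exact h.mono_left nhdsWithin_le_nhds
  refine ge_of_tendsto ht ?_
  filter_upwards [Ioo_mem_nhdsGT (zero_lt_one (α := ℝ))] with q hq
  exact mgf_step d g L hgm hg hint h0 l hl q hq.1 hq.2

lemma integrable_norm_stdGauss (d : ℕ) : Integrable (fun z => ‖z‖) (stdGauss d) := by
  rw [stdGauss, integrable_withDensity_iff (by fun_prop) (by simp)]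
  have h := (GaussianFourier.integrable_cexp_neg_mul_sq_norm_add (V := EuclideanSpace ℝ (Fin d))
    (b := (1/4 : ℂ)) (by norm_num) 0 0).norm
  have hC : (0:ℝ) < (2 * π) ^ (-(d : ℝ) / 2) := by positivity
  refine (h.const_mul (4 * (2 * π) ^ (-(d : ℝ) / 2))).mono' (by fun_prop) ?_
  refine Filter.Eventually.of_forall fun z => ?_
  rw [ENNReal.toReal_ofReal (by positivity), Real.norm_of_nonneg (by positivity), Complex.norm_exp]
  have e : (-(1/4 : ℂ) * (‖z‖ : ℂ) ^ 2 + 0 * ((inner ℝ 0 z : ℝ) : ℂ)).re = -(‖z‖ ^ 2 / 4) := by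
    rw [zero_mul, add_zero]
    have : (-(1/4 : ℂ) * (‖z‖ : ℂ) ^ 2) = ((-(‖z‖ ^ 2 / 4) : ℝ) : ℂ) := by push_cast; ring
    rw [this, Complex.ofReal_re]
  rw [e]
  have h1 : ‖z‖ ≤ 4 * Real.exp (‖z‖ ^ 2 / 4) := by
    have := Real.add_one_le_exp (‖z‖ ^ 2 / 4)
    nlinarith [sq_nonneg (‖z‖ - 1)]
  have h2 : Real.exp (‖z‖ ^ 2 / 4) * Real.exp (-‖z‖ ^ 2 / 2) = Real.exp (-(‖z‖ ^ 2 / 4)) := by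
    rw [← Real.exp_add]; congr 1; ring
  calc ‖z‖ * ((2 * π) ^ (-(d : ℝ) / 2) * Real.exp (-‖z‖ ^ 2 / 2))
      ≤ (4 * Real.exp (‖z‖ ^ 2 / 4)) * ((2 * π) ^ (-(d : ℝ) / 2) * Real.exp (-‖z‖ ^ 2 / 2)) := by
        gcongr
    _ = 4 * (2 * π) ^ (-(d : ℝ) / 2) * (Real.exp (‖z‖ ^ 2 / 4) * Real.exp (-‖z‖ ^ 2 / 2)) := by ring
    _ = _ := by rw [h2]

lemma gauss_tail (d : ℕ) [IsProbabilityMeasure (stdGauss d)] (g : EuclideanSpace ℝ (Fin d) → ℝ)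
    (L : ℝ) (hL : 0 < L) (hgm : Measurable g) (hg : ∀ x y, g x - g y ≤ L * ‖x - y‖)
    (hint : Integrable g (stdGauss d)) (r : ℝ) (hr : 0 ≤ r) :
    stdGauss d {z | (∫ z, g z ∂(stdGauss d)) + r ≤ g z} ≤
      ENNReal.ofReal (Real.exp (-(1 / (2 * L ^ 2)) * r ^ 2)) := by
  set M := ∫ z, g z ∂(stdGauss d) with hM
  have hb := mgf_bound d (fun z => g z - M) L (by fun_prop) (fun x y => by simpa using hg x y)
    (hint.sub (integrable_const _))
    (by rw [integral_sub hint (integrable_const _)]; simp [hM]) (r / L ^ 2) (by positivity)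
  have hc : stdGauss d {z | M + r ≤ g z} ≤
      ∫⁻ z, ENNReal.ofReal (Real.exp (-(r ^ 2 / L ^ 2))) *
        ENNReal.ofReal (Real.exp (r / L ^ 2 * (g z - M))) ∂(stdGauss d) := by
    rw [← lintegral_indicator_one (measurableSet_le measurable_const hgm)]
    refine lintegral_mono (Set.indicator_le' (fun z hz => ?_) (fun _ _ => zero_le))
    rw [← ENNReal.ofReal_mul (by positivity), ← Real.exp_add, Pi.one_apply, ENNReal.one_le_ofReal,
      Real.one_le_exp_iff]
    have h1 : r ≤ g z - M := by simp only [Set.mem_setOf_eq] at hz; linarith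
    have h2 : r / L ^ 2 * r ≤ r / L ^ 2 * (g z - M) := by gcongr
    have h3 : r / L ^ 2 * r = r ^ 2 / L ^ 2 := by ring
    linarith
  rw [lintegral_const_mul _ (by fun_prop)] at hc
  refine (hc.trans (mul_le_mul_right hb _)).trans (le_of_eq ?_)
  rw [← ENNReal.ofReal_mul (by positivity), ← Real.exp_add]
  congr 2
  field_simp
  ring

/-- Gaussian concentration for `f(X + δZ)` when `X ~ μ` is supported in
`B(0,R)`, `Z ~ N(0,I_d)` is independent of `X`, and `f` is 1-Lipschitz:
`P(f(X + δZ) ≥ m + t) ≤ exp(-(1/(2δ²)) (t - 2R)₊²)` for all `t ≥ 0`. -/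
theorem concentration_conv (d : ℕ) (hd : 1 ≤ d) (R δ : ℝ) (hR : 0 < R) (hδ : 0 < δ)
    (Ω : Type*) [MeasureSpace Ω] [IsProbabilityMeasure (ℙ : Measure Ω)]
    (μ : Measure (EuclideanSpace ℝ (Fin d))) [IsProbabilityMeasure μ]
    (hsupp : μ (closedBall (0 : EuclideanSpace ℝ (Fin d)) R)ᶜ = 0)
    (X Z : Ω → EuclideanSpace ℝ (Fin d)) (hXm : Measurable X) (hZm : Measurable Z)
    (hX : Measure.map X ℙ = μ) (hZ : Measure.map Z ℙ = stdGauss d)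
    (hindep : IndepFun X Z ℙ)
    (f : EuclideanSpace ℝ (Fin d) → ℝ) (hf : LipschitzWith 1 f)
    (m : ℝ) (hm : m = ∫ ω, f (X ω + δ • Z ω)) :
    ∀ t : ℝ, 0 ≤ t →
      ℙ {ω | m + t ≤ f (X ω + δ • Z ω)} ≤
        ENNReal.ofReal (Real.exp (-(1 / (2 * δ ^ 2)) * max (t - 2 * R) 0 ^ 2)) := by
  intro t ht
  haveI : IsProbabilityMeasure (stdGauss d) := by
    rw [← hZ]; exact Measure.isProbabilityMeasure_map hZm.aemeasurable
  have hfc : Continuous f := hf.continuous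
  have hfm : Measurable f := hfc.measurable
  have hlip : ∀ x y, f x - f y ≤ ‖x - y‖ := fun x y => by
    have := hf.dist_le_mul x y
    rw [Real.dist_eq, dist_eq_norm] at this
    simp only [NNReal.coe_one, one_mul] at this
    exact (le_abs_self _).trans this
  rcases le_or_gt t (2 * R) with h | h
  · rw [max_eq_right (by linarith)]
    simpa using prob_le_one
  rw [max_eq_left (by linarith)]
  set g : EuclideanSpace ℝ (Fin d) → ℝ := fun z => f (δ • z) with hgdef
  have hgm : Measurable g := by fun_prop
  have hgl : ∀ x y, g x - g y ≤ δ * ‖x - y‖ := fun x y => by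
    refine (hlip _ _).trans (le_of_eq ?_)
    rw [← smul_sub, norm_smul, Real.norm_of_nonneg hδ.le]
  have hgi : Integrable g (stdGauss d) := by
    refine Integrable.mono' (((integrable_norm_stdGauss d).const_mul δ).add
      (integrable_const |g 0|)) (by fun_prop) (Filter.Eventually.of_forall fun z => ?_)
    have h1 := hgl z 0
    have h2 := hgl 0 z
    rw [norm_sub_rev] at h2
    simp only [sub_zero] at h1 h2
    rw [Real.norm_eq_abs, Pi.add_apply]
    have a1 := le_abs_self (g 0)
    have a2 := neg_abs_le (g 0)
    exact abs_le.2 ⟨by linarith, by linarith⟩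
  have hXR : ∀ᵐ ω, ‖X ω‖ ≤ R := by
    rw [← hX, Measure.map_apply hXm (measurableSet_closedBall.compl)] at hsupp
    rw [ae_iff]
    convert hsupp using 2
    ext ω; simp
  have hgZ : Integrable (fun ω => g (Z ω)) (ℙ : Measure Ω) := by
    rw [← hZ] at hgi
    exact hgi.comp_measurable hZm
  have hM : ∫ z, g z ∂(stdGauss d) = ∫ ω, g (Z ω) := by
    rw [← hZ]; exact integral_map hZm.aemeasurable hgm.aestronglyMeasurable
  have hup : ∀ᵐ ω, f (X ω + δ • Z ω) ≤ g (Z ω) + R ∧ g (Z ω) - R ≤ f (X ω + δ • Z ω) := by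
    filter_upwards [hXR] with ω hω
    have h1 := hlip (X ω + δ • Z ω) (δ • Z ω)
    have h2 := hlip (δ • Z ω) (X ω + δ • Z ω)
    rw [norm_sub_rev] at h2
    rw [add_sub_cancel_right] at h1 h2
    simp only [hgdef]
    constructor <;> linarith
  have hfi : Integrable (fun ω => f (X ω + δ • Z ω)) (ℙ : Measure Ω) := by
    refine Integrable.mono' (hgZ.norm.add (integrable_const R))
      (by fun_prop) ?_
    filter_upwards [hup] with ω hω
    rw [Real.norm_eq_abs, Pi.add_apply, Real.norm_eq_abs]
    have a1 := le_abs_self (g (Z ω))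
    have a2 := neg_abs_le (g (Z ω))
    exact abs_le.2 ⟨by linarith, by linarith⟩
  have hmM : ∫ z, g z ∂(stdGauss d) - R ≤ m := by
    rw [hM, hm]
    calc (∫ ω, g (Z ω)) - R = ∫ ω, (g (Z ω) - R) := by
          rw [integral_sub hgZ (integrable_const _)]; simp
      _ ≤ _ := integral_mono_ae (hgZ.sub (integrable_const _)) hfi (hup.mono fun ω h => h.2)
  refine le_trans ?_ (gauss_tail d g δ hδ hgm hgl hgi (t - 2 * R) (by linarith))
  conv_rhs => rw [← hZ]
  rw [Measure.map_apply hZm (measurableSet_le measurable_const hgm), hZ]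
  refine measure_mono_ae ?_
  filter_upwards [hup] with ω hω hω2
  have h3 : m + t ≤ f (X ω + δ • Z ω) := hω2
  change (∫ z, g z ∂(stdGauss d)) + (t - 2 * R) ≤ g (Z ω)
  linarith
end
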